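/- Let n₀ = 3^k with k ≥ 1 and let n = 3·n₀². There exist no positive divisor t of n + 3n₀ + 1 and integer g ≥ 2 such that 2g = (n − 1)·(t·(n + 1)·(n − 3n₀ + 1) − (n² + n + 1)) and 3g < 2n³. -/

import Mathlib

/-- Case (B) of the Ree analysis cannot occur. -/
theorem stmt_10 (k : ℕ) (hk : 1 ≤ k) (n₀ n : ℕ) (hn₀ : n₀ = 3 ^ k)
    (hn : n = 3 * n₀ ^ 2) :
    ¬ ∃ (t : ℕ) (g : ℤ), 0 < t ∧ t ∣ n + 3 * n₀ + 1 ∧ 2 ≤ g ∧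
      2 * g = ((n : ℤ) - 1) *
        ((t : ℤ) * ((n : ℤ) + 1) * ((n : ℤ) - 3 * (n₀ : ℤ) + 1) - ((n : ℤ) ^ 2 + n + 1)) ∧
      3 * g < 2 * (n : ℤ) ^ 3 := by
  rintro ⟨t, g, ht, hdvd, hg, hgenus, hlt⟩
  have hm : 3 ≤ n₀ := hn₀ ▸ Nat.le_self_pow (by omega) 3
  have hodd : n₀ % 2 = 1 := by
    rw [hn₀, Nat.pow_mod]
    simp
  have hn_odd : n % 2 = 1 := by
    simp [hn, Nat.mul_mod, Nat.pow_mod, hodd]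
  have ht' : t = 1 ∨ 5 ≤ t := by
    by_contra! h
    obtain ⟨h1, h5⟩ := h
    obtain rfl | rfl | rfl : t = 2 ∨ t = 3 ∨ t = 4 := by omega
    all_goals omega
  have hmZ : (3 : ℤ) ≤ n₀ := by exact_mod_cast hm
  have hnZ : (n : ℤ) = 3 * (n₀ : ℤ) ^ 2 := by exact_mod_cast hn
  rw [hnZ] at hgenus hlt
  generalize (n₀ : ℤ) = m at hmZ hgenus hlt
  obtain ⟨u, rfl⟩ : ∃ u, m = u + 3 := ⟨m - 3, by ring⟩
  have hu : 0 ≤ u := by linarith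
  rcases ht' with rfl | h5
  · have hneg : 2 * g + 2 * (3 * (u + 3) ^ 2 - 1) * (u + 3) ^ 2 ≤ 0 := by
      rw [hgenus, ← sub_nonneg]
      ring_nf
      positivity
    have hpos : 0 ≤ 2 * (3 * (u + 3) ^ 2 - 1) * (u + 3) ^ 2 := by
      ring_nf
      positivity
    linarith
  · obtain ⟨s, hs⟩ : ∃ s : ℕ, t = s + 5 := ⟨t - 5, by omega⟩
    have hlarge : 4 * (3 * (u + 3) ^ 2) ^ 3 ≤ 3 * (2 * g) := by
      rw [hgenus, ← sub_nonneg, hs]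
      push_cast
      ring_nf
      positivity
    linarith
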